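/- Suppose κ₀ > 0, ε ∈ (0,1), δ(ε) ∈ (0,1), Λ > f(0⁺)+1, and Λ·ν(D) ≥ κ₀·ε² (so that A_{ε,Λ} is nonempty). Then the functional E is bounded from above on A_{ε,Λ} and attains its maximum on A_{ε,Λ}: there exists ζ₀ ∈ A_{ε,Λ} with E(ζ₀) = sup_{ζ ∈ A_{ε,Λ}} E(ζ). -/

import Mathlib

open MeasureTheory Metric Real Set Filter

noncomputable section

abbrev Pt : Type := EuclideanSpace ℝ (Fin 2)

/-- The operator `K` of the abstract lake-kernel setup:
`Kζ(x) = b(x)∫_D G(x,y)ζ(y) dν(y) + ∫_D R(x,y)ζ(y) dν(y)`, where `dν = b dm`. -/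
def Kop (D : Set Pt) (b : Pt → ℝ) (G R : Pt → Pt → ℝ) (ζ : Pt → ℝ) (x : Pt) : ℝ :=
  b x * (∫ y in D, G x y * ζ y * b y) + ∫ y in D, R x y * ζ y * b y

/-- `F_*(s) = ∫₀^s f⁻¹(r) dr`. -/
def Fstar (finv : ℝ → ℝ) (s : ℝ) : ℝ := ∫ r in (0:ℝ)..s, finv r

/-- The admissible class `A_{ε,Λ}`:
`0 ≤ ζ ≤ Λδ(ε)/ε²` a.e. in `D` and `∫_D ζ dν = κ₀ δ(ε)`. -/
def InA (D : Set Pt) (b : Pt → ℝ) (κ₀ ε δ Λ : ℝ) (ζ : Pt → ℝ) : Prop :=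
  Measurable ζ ∧ (∀ᵐ x ∂(volume.restrict D), 0 ≤ ζ x ∧ ζ x ≤ Λ * δ / ε ^ 2) ∧
    (∫ x in D, ζ x * b x) = κ₀ * δ

/-- The energy functional
`E(ζ) = (1/2)∫_D ζ·Kζ dν + ∫_D qζ dν − (δ/ε²)∫_D F_*((ε²/δ)ζ) dν`. -/
def Efun (D : Set Pt) (b q : Pt → ℝ) (G R : Pt → Pt → ℝ) (finv : ℝ → ℝ)
    (ε δ : ℝ) (ζ : Pt → ℝ) : ℝ :=
  (1/2) * (∫ x in D, ζ x * Kop D b G R ζ x * b x)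
    + (∫ x in D, q x * ζ x * b x)
    - (δ / ε ^ 2) * ∫ x in D, Fstar finv ((ε ^ 2 / δ) * ζ x) * b x

lemma weak_compact_aux (μ : Measure Pt) [IsFiniteMeasure μ] (M : ℝ) (ζ : ℕ → Pt → ℝ)
    (hm : ∀ n, Measurable (ζ n)) (hb : ∀ n, ∀ᵐ x ∂μ, 0 ≤ ζ n x ∧ ζ n x ≤ M) :
    ∃ (φ : ℕ → ℕ) (z : Pt → ℝ), StrictMono φ ∧ Measurable z ∧ (∀ᵐ x ∂μ, 0 ≤ z x ∧ z x ≤ M) ∧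
      ∀ g : Pt → ℝ, MemLp g 2 μ →
        Tendsto (fun n => ∫ x, ζ (φ n) x * g x ∂μ) atTop (nhds (∫ x, z x * g x ∂μ)) := by
  have : Fact ((2:ENNReal) ≠ ⊤) := ⟨by simp⟩
  have : SecondCountableTopology (Lp ℝ 2 μ) := inferInstance
  have hmem : ∀ n, MemLp (ζ n) 2 μ := fun n =>
    MemLp.of_bound (hm n).aestronglyMeasurable M (by
      filter_upwards [hb n] with x hx
      rw [Real.norm_eq_abs, abs_of_nonneg hx.1]; exact hx.2)
  let Z : ℕ → Lp ℝ 2 μ := fun n => (hmem n).toLp (ζ n)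
  obtain ⟨r, hr⟩ : ∃ r : ℝ, ∀ n, ‖Z n‖ ≤ r := by
    refine ⟨(μ univ).toReal ^ ((2:ENNReal).toReal)⁻¹ * |M|, fun n => ?_⟩
    refine Lp.norm_le_of_ae_bound (abs_nonneg M) ?_
    filter_upwards [hb n, (hmem n).coeFn_toLp] with x hx h2
    rw [h2, Real.norm_eq_abs, abs_of_nonneg hx.1]; exact hx.2.trans (le_abs_self _)
  let W : ℕ → WeakDual ℝ (Lp ℝ 2 μ) := fun n =>
    StrongDual.toWeakDual (InnerProductSpace.toDual ℝ (Lp ℝ 2 μ) (Z n))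
  have hW : ∀ n, W n ∈ (fun u : WeakDual ℝ (Lp ℝ 2 μ) => WeakDual.toStrongDual u) ⁻¹'
      Metric.closedBall (0 : StrongDual ℝ (Lp ℝ 2 μ)) r := by
    intro n
    simp only [W, mem_preimage, mem_closedBall, dist_zero_right]
    exact ((InnerProductSpace.toDual ℝ (Lp ℝ 2 μ)).norm_map (Z n)).le.trans (hr n)
  obtain ⟨w, -, φ, hφ, hlim⟩ := WeakDual.isSeqCompact_closedBall ℝ (Lp ℝ 2 μ) 0 r hW
  let z0 : Lp ℝ 2 μ := (InnerProductSpace.toDual ℝ (Lp ℝ 2 μ)).symm (WeakDual.toStrongDual w)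
  obtain ⟨z, hzm, hz⟩ := (Lp.aestronglyMeasurable z0).aemeasurable
  have hconv : ∀ g : Pt → ℝ, MemLp g 2 μ →
        Tendsto (fun n => ∫ x, ζ (φ n) x * g x ∂μ) atTop (nhds (∫ x, z x * g x ∂μ)) := by
    intro g hg
    have h1 := (WeakDual.eval_continuous (𝕜 := ℝ) (hg.toLp g)).continuousAt.tendsto.comp hlim
    have e1 : ∀ n, W n (hg.toLp g) = ∫ x, ζ n x * g x ∂μ := by
      intro n
      change inner ℝ (Z n) (hg.toLp g) = _
      rw [L2.inner_def]
      refine integral_congr_ae ?_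
      filter_upwards [hg.coeFn_toLp, (hmem n).coeFn_toLp] with x h1 h2
      simp only [Z]
      rw [h1, h2]; simp [mul_comm]
    have e2 : w (hg.toLp g) = ∫ x, z x * g x ∂μ := by
      have : w (hg.toLp g) = inner ℝ z0 (hg.toLp g) := by
        simp only [z0, InnerProductSpace.toDual_symm_apply]; rfl
      rw [this, L2.inner_def]
      refine integral_congr_ae ?_
      filter_upwards [hg.coeFn_toLp, hz] with x h1 h2
      rw [h1, h2]; simp [mul_comm]
    have : (fun n => ∫ x, ζ (φ n) x * g x ∂μ) = (fun n => W (φ n) (hg.toLp g)) := by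
      funext n; rw [e1]
    rw [this, ← e2]; exact h1
  have hzmem : MemLp z 2 μ := (memLp_congr_ae hz).1 (Lp.memLp z0)
  have hzint : Integrable z μ := hzmem.integrable (by norm_num)
  have hind : ∀ (s : Set Pt), MeasurableSet s → ∀ h : Pt → ℝ,
      ∫ x, h x * s.indicator (fun _ => (1:ℝ)) x ∂μ = ∫ x in s, h x ∂μ := by
    intro s hs h
    rw [← integral_indicator hs]
    congr 1; funext x; by_cases hx : x ∈ s <;> simp [hx]
  have hsl : ∀ s, MeasurableSet s → 
      Tendsto (fun n => ∫ x in s, ζ (φ n) x ∂μ) atTop (nhds (∫ x in s, z x ∂μ)) := by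
    intro s hs
    have := hconv (s.indicator (fun _ => (1:ℝ))) ((memLp_const 1).indicator hs)
    simpa only [hind s hs] using this
  refine ⟨φ, z, hφ, hzm, ?_, hconv⟩
  have h0 : 0 ≤ᵐ[μ] z := by
    refine ae_nonneg_of_forall_setIntegral_nonneg hzint fun s hs _ => ?_
    refine ge_of_tendsto' (hsl s hs) fun n => ?_
    exact integral_nonneg_of_ae (ae_restrict_of_ae ((hb (φ n)).mono fun x hx => hx.1))
  have hM : z ≤ᵐ[μ] fun _ => M := by
    refine ae_le_of_forall_setIntegral_le hzint (integrable_const _) fun s hs _ => ?_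
    refine le_of_tendsto' (hsl s hs) fun n => ?_
    exact integral_mono_ae ((hmem (φ n)).integrable (by norm_num)).integrableOn (integrable_const _)
      (ae_restrict_of_ae ((hb (φ n)).mono fun x hx => hx.2))
  filter_upwards [h0, hM] with x h1 h2 using ⟨h1, h2⟩

lemma inv_norm_aux (r : ℝ) : IntegrableOn (fun x : Pt => ‖x‖⁻¹) (ball (0:Pt) r) := by
  rw [integrableOn_fun_norm_addHaar volume (f := fun y => y⁻¹)]
  have : IntegrableOn (fun _ : ℝ => (1:ℝ)) (Ioo 0 r) := integrableOn_const (by simp)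
  refine this.congr_fun ?_ measurableSet_Ioo
  intro y hy
  simp [hy.1.ne']

/-- uniform bound for the singular integral. -/
lemma inv_dist_aux (D : Set Pt) (hDbdd : Bornology.IsBounded D) :
    ∃ C : ℝ, 0 ≤ C ∧ ∀ x ∈ D, IntegrableOn (fun y => (dist x y)⁻¹) D ∧ ∫ y in D, (dist x y)⁻¹ ≤ C := by
  have h0 := inv_norm_aux (diam D + 1)
  refine ⟨∫ x in ball (0:Pt) (diam D + 1), ‖x‖⁻¹, integral_nonneg fun x => by positivity, ?_⟩
  intro x hx
  have hmp : MeasurePreserving (fun y : Pt => x - y) volume volume :=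
    Measure.measurePreserving_sub_left volume x
  have hemb : MeasurableEmbedding (fun y : Pt => x - y) :=
    (Homeomorph.subLeft x).measurableEmbedding
  have hsub : D ⊆ (fun y : Pt => x - y) ⁻¹' ball (0:Pt) (diam D + 1) := by
    intro y hy
    have := dist_le_diam_of_mem hDbdd hx hy
    simp only [mem_preimage, mem_ball, dist_zero_right, ← dist_eq_norm]; linarith
  have hI : IntegrableOn (fun y => (dist x y)⁻¹) ((fun y : Pt => x - y) ⁻¹' ball (0:Pt) (diam D + 1)) := by
    have := (hmp.integrableOn_comp_preimage hemb (f := fun x : Pt => ‖x‖⁻¹) (s := ball (0:Pt) (diam D + 1))).2 h0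
    simpa [Function.comp_def, dist_eq_norm] using this
  refine ⟨hI.mono_set hsub, ?_⟩
  calc ∫ y in D, (dist x y)⁻¹ ≤ ∫ y in ((fun y : Pt => x - y) ⁻¹' ball (0:Pt) (diam D + 1)), (dist x y)⁻¹ :=
        setIntegral_mono_set hI (ae_of_all _ fun y => by simp) hsub.eventuallyLE
    _ = _ := by
      have := hmp.setIntegral_preimage_emb hemb (fun x : Pt => ‖x‖⁻¹) (ball (0:Pt) (diam D + 1))
      simpa only [dist_eq_norm] using this

lemma G_aux (D : Set Pt) (hD : MeasurableSet D) (hDbdd : Bornology.IsBounded D)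
    [IsFiniteMeasure (volume.restrict D)]
    (G : Pt → Pt → ℝ) (hGm : Measurable (Function.uncurry G))
    (hGbd : ∀ᵐ p ∂((volume.restrict D).prod (volume.restrict D)),
      0 ≤ G p.1 p.2 ∧ G p.1 p.2 ≤ (1 / (2 * π)) * log (diam D / dist p.1 p.2)) :
    ∃ C : ℝ, 0 ≤ C ∧ ∀ᵐ x ∂(volume.restrict D), MemLp (G x) 2 (volume.restrict D) ∧
      ∫ y in D, |G x y| ≤ C := by
  obtain ⟨C, hC0, hC⟩ := inv_dist_aux D hDbdd
  have hd : 0 ≤ diam D := diam_nonneg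
  refine ⟨(∫ y in D, (1:ℝ)) + diam D * C, ?_, ?_⟩
  · exact add_nonneg (integral_nonneg fun x => by positivity) (by positivity)
  have hGbd' := Measure.ae_ae_of_ae_prod hGbd
  filter_upwards [hGbd', ae_restrict_mem hD] with x hx hxD
  obtain ⟨hI, hIC⟩ := hC x hxD
  have hGx : Measurable (G x) := hGm.comp measurable_prodMk_left
  have hsq : ∀ᵐ y ∂(volume.restrict D), (G x y)^2 ≤ diam D * (dist x y)⁻¹ := by
    filter_upwards [hx] with y hy
    have ht : 0 ≤ diam D / dist x y := by positivity
    have h1 := Real.log_le_rpow_div ht (show (0:ℝ) < 1/2 by norm_num)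
    rw [← Real.sqrt_eq_rpow] at h1
    have h2 : G x y ≤ √(diam D / dist x y) := by
      refine hy.2.trans ?_
      have hp := Real.pi_gt_three
      have hs := Real.sqrt_nonneg (diam D / dist x y)
      calc (1 / (2 * π)) * log (diam D / dist x y) 
          ≤ (1 / (2 * π)) * (√(diam D / dist x y) / (1/2)) := by gcongr
        _ = √(diam D / dist x y) / π := by field_simp
        _ ≤ √(diam D / dist x y) := div_le_self hs (by linarith)
    calc (G x y)^2 ≤ (√(diam D / dist x y))^2 := by
          have := hy.1
          gcongr
      _ = diam D * (dist x y)⁻¹ := by rw [Real.sq_sqrt ht, div_eq_mul_inv]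
  have hIs : Integrable (fun y => (G x y)^2) (volume.restrict D) := by
    refine Integrable.mono' (hI.const_mul (diam D)) (hGx.pow_const 2).aestronglyMeasurable ?_
    filter_upwards [hsq] with y hy
    rwa [Real.norm_eq_abs, abs_of_nonneg (sq_nonneg _)]
  refine ⟨(memLp_two_iff_integrable_sq hGx.aestronglyMeasurable).2 hIs, ?_⟩
  have hle : ∫ y in D, |G x y| ≤ ∫ y in D, ((1:ℝ) + diam D * (dist x y)⁻¹) := by
    refine integral_mono_of_nonneg (ae_of_all _ fun y => abs_nonneg _)
      ((integrable_const _).add (hI.const_mul _)) ?_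
    filter_upwards [hsq] with y hy
    have := sq_nonneg (|G x y| - 1)
    have h3 : |G x y|^2 = (G x y)^2 := sq_abs _
    have h4 := abs_nonneg (G x y)
    nlinarith
  refine hle.trans ?_
  rw [integral_add (integrable_const _) (hI.const_mul _), integral_const_mul]
  gcongr

lemma Fstar_convex (finv : ℝ → ℝ) (hmono : Monotone finv) (s t : ℝ) :
    Fstar finv t + finv t * (s - t) ≤ Fstar finv s := by
  have hint : ∀ a b, IntervalIntegrable finv volume a b := fun _ _ => hmono.intervalIntegrable
  have hadd : Fstar finv t + ∫ r in t..s, finv r = Fstar finv s :=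
    intervalIntegral.integral_add_adjacent_intervals (hint 0 t) (hint t s)
  rw [← hadd]
  gcongr
  rcases le_total t s with h | h
  · have := intervalIntegral.integral_mono_on h (intervalIntegrable_const (c := finv t) (μ := volume))
      (hint t s) (fun r hr => hmono hr.1)
    simp at this; linarith
  · have := intervalIntegral.integral_mono_on h (hint s t)
      (intervalIntegrable_const (c := finv t) (μ := volume)) (fun r hr => hmono hr.2)
    rw [intervalIntegral.integral_symm]
    simp at this; linarith

lemma Fstar_cont (finv : ℝ → ℝ) (hmono : Monotone finv) : Continuous (Fstar finv) :=
  intervalIntegral.continuous_primitive (fun _ _ => hmono.intervalIntegrable) 0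

lemma Kop_meas (D : Set Pt) [IsFiniteMeasure (volume.restrict D)] (b : Pt → ℝ) (hbm : Measurable b)
    (G : Pt → Pt → ℝ) (hGm : Measurable (Function.uncurry G))
    (R : Pt → Pt → ℝ) (hRm : Measurable (Function.uncurry R)) (ζ : Pt → ℝ) (hζ : Measurable ζ) :
    Measurable (Kop D b G R ζ) := by
  have key : ∀ H : Pt → Pt → ℝ, Measurable (Function.uncurry H) →
      Measurable (fun x => ∫ y in D, H x y * ζ y * b y) := by
    intro H hH
    have : Measurable (Function.uncurry (fun x y => H x y * ζ y * b y)) :=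
      (hH.mul (hζ.comp measurable_snd)).mul (hbm.comp measurable_snd)
    exact (this.stronglyMeasurable.integral_prod_right).measurable
  exact (hbm.mul (key G hGm)).add (key R hRm)

lemma Kop_bound (D : Set Pt) [IsFiniteMeasure (volume.restrict D)]
    (b : Pt → ℝ) (B : ℝ) (hB : ∀ x, |b x| ≤ B)
    (G R : Pt → Pt → ℝ) (CR : ℝ) (hCR : ∀ x y, |R x y| ≤ CR) (C M : ℝ) (hM : 0 ≤ M)
    (x : Pt) (hGx : MemLp (G x) 2 (volume.restrict D)) (hC : ∫ y in D, |G x y| ≤ C)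
    (ζ : Pt → ℝ) (hζ : ∀ᵐ x ∂(volume.restrict D), 0 ≤ ζ x ∧ ζ x ≤ M) :
    |Kop D b G R ζ x| ≤ B * (C * (M * B)) + ∫ y in D, CR * M * B := by
  have hB0 : 0 ≤ B := (abs_nonneg _).trans (hB 0)
  have hCR0 : 0 ≤ CR := (abs_nonneg _).trans (hCR 0 0)
  have h1 : |∫ y in D, G x y * ζ y * b y| ≤ C * (M * B) := by
    have : ‖∫ y in D, G x y * ζ y * b y‖ ≤ ∫ y in D, |G x y| * (M * B) := by
      refine norm_integral_le_of_norm_le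
        ((hGx.integrable (by norm_num)).abs.mul_const _) ?_
      filter_upwards [hζ] with y hy
      rw [Real.norm_eq_abs, abs_mul, abs_mul, abs_of_nonneg hy.1, mul_assoc]
      have := hB y; have := hy.1; have := hy.2
      gcongr
    rw [integral_mul_const] at this
    exact this.trans (by gcongr)
  have h2 : |∫ y in D, R x y * ζ y * b y| ≤ ∫ y in D, CR * M * B := by
    rw [← Real.norm_eq_abs]
    refine norm_integral_le_of_norm_le (integrable_const (μ := volume.restrict D) _) ?_
    filter_upwards [hζ] with y hy
    rw [Real.norm_eq_abs, abs_mul, abs_mul, abs_of_nonneg hy.1]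
    have := hB y; have := hy.1; have := hy.2; have := hCR x y
    gcongr
  unfold Kop
  refine (abs_add_le _ _).trans ?_
  rw [abs_mul]
  have := hB x
  gcongr

lemma seq_aux (D : Set Pt) (hD : MeasurableSet D) (hDbdd : Bornology.IsBounded D)
    [IsFiniteMeasure (volume.restrict D)]
    (b : Pt → ℝ) (hbm : Measurable b) (B : ℝ) (hB : ∀ x, |b x| ≤ B) (hb0 : ∀ x, 0 ≤ b x)
    (q : Pt → ℝ) (hqm : Measurable q) (Q : ℝ) (hQ : ∀ x, |q x| ≤ Q)
    (G : Pt → Pt → ℝ) (hGm : Measurable (Function.uncurry G))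
    (hGbd : ∀ᵐ p ∂((volume.restrict D).prod (volume.restrict D)),
      0 ≤ G p.1 p.2 ∧ G p.1 p.2 ≤ (1 / (2 * π)) * log (diam D / dist p.1 p.2))
    (R : Pt → Pt → ℝ) (hRm : Measurable (Function.uncurry R))
    (CR : ℝ) (hCR : ∀ x y, |R x y| ≤ CR)
    (finv : ℝ → ℝ) (hmono : Monotone finv)
    (κ₀ ε δ Λ : ℝ) (hε : 0 < ε) (hδ : 0 < δ) (hΛ : 0 < Λ)
    (ζ : ℕ → Pt → ℝ) (hζ : ∀ n, InA D b κ₀ ε δ Λ (ζ n)) :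
    ∃ (φ : ℕ → ℕ) (z : Pt → ℝ) (h : ℕ → ℝ), StrictMono φ ∧ InA D b κ₀ ε δ Λ z ∧
      Tendsto h atTop (nhds (Efun D b q G R finv ε δ z)) ∧
      ∀ n, Efun D b q G R finv ε δ (ζ (φ n)) ≤ h n := by
  set M : ℝ := Λ * δ / ε ^ 2 with hMdef
  have hM : 0 ≤ M := by positivity
  have hB0 : 0 ≤ B := (abs_nonneg _).trans (hB 0)
  obtain ⟨φ, z, hφ, hzm, hzb, hconv⟩ := weak_compact_aux (volume.restrict D) M ζ
    (fun n => (hζ n).1) (fun n => (hζ n).2.1)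
  have hbLp : MemLp b 2 (volume.restrict D) :=
    MemLp.of_bound hbm.aestronglyMeasurable B (ae_of_all _ hB)
  have hzA : InA D b κ₀ ε δ Λ z := by
    refine ⟨hzm, hzb, ?_⟩
    have := hconv b hbLp
    simp only [(hζ _).2.2] at this
    exact tendsto_nhds_unique this tendsto_const_nhds
  -- the quadratic term
  obtain ⟨C, hC0, hC⟩ := G_aux D hD hDbdd G hGm hGbd
  set KC : ℝ := B * (C * (M * B)) + ∫ y in D, CR * M * B with hKC
  have hKz := Kop_meas D b hbm G hGm R hRm z hzm
  have hKzb : ∀ᵐ x ∂(volume.restrict D), |Kop D b G R z x| ≤ KC := by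
    filter_upwards [hC] with x hx
    exact Kop_bound D b B hB G R CR hCR C M hM x hx.1 hx.2 z hzb
  have hKnb : ∀ᵐ x ∂(volume.restrict D), ∀ n, |Kop D b G R (ζ (φ n)) x| ≤ KC := by
    filter_upwards [hC] with x hx n
    exact Kop_bound D b B hB G R CR hCR C M hM x hx.1 hx.2 _ (hζ (φ n)).2.1
  have hζb : ∀ᵐ x ∂(volume.restrict D), ∀ n, 0 ≤ ζ (φ n) x ∧ ζ (φ n) x ≤ M :=
    ae_all_iff.2 fun n => (hζ (φ n)).2.1
  have hKlim : ∀ᵐ x ∂(volume.restrict D),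
      Tendsto (fun n => Kop D b G R (ζ (φ n)) x) atTop (nhds (Kop D b G R z x)) := by
    filter_upwards [hC] with x hx
    have e : ∀ (H : Pt → Pt → ℝ) (w : Pt → ℝ),
        ∫ y in D, H x y * w y * b y = ∫ y in D, w y * (H x y * b y) := by
      intro H w; congr 1; funext y; ring
    unfold Kop
    simp only [e]
    refine Tendsto.add (Tendsto.const_mul _ (hconv _ ?_)) (hconv _ ?_)
    · refine MemLp.of_le_mul (c := B) hx.1 (hx.1.1.mul hbm.aestronglyMeasurable) (ae_of_all _ ?_)
      intro y
      rw [norm_mul, mul_comm]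
      have := hB y
      rw [← Real.norm_eq_abs] at this
      gcongr
    · refine MemLp.of_bound (C := CR * B) ?_ (ae_of_all _ ?_)
      · exact ((hRm.comp measurable_prodMk_left).mul hbm).aestronglyMeasurable
      · intro y
        rw [Real.norm_eq_abs, abs_mul]
        have := hB y; have := hCR x y
        have := (abs_nonneg _).trans (hCR 0 0)
        gcongr
  have hQ1 : Tendsto (fun n => ∫ x in D,
      ζ (φ n) x * (Kop D b G R (ζ (φ n)) x - Kop D b G R z x) * b x) atTop (nhds 0) := by
    have := tendsto_integral_of_dominated_convergence (μ := volume.restrict D)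
      (F := fun n x => ζ (φ n) x * (Kop D b G R (ζ (φ n)) x - Kop D b G R z x) * b x)
      (f := fun _ => (0:ℝ)) (fun _ => M * (KC + KC) * B) ?_ (integrable_const _) ?_ ?_
    · simpa using this
    · intro n
      exact (((hζ (φ n)).1.mul ((Kop_meas D b hbm G hGm R hRm _ (hζ (φ n)).1).sub hKz)).mul
        hbm).aestronglyMeasurable
    · intro n
      filter_upwards [hζb, hKzb, hKnb] with x h1 h2 h3
      rw [Real.norm_eq_abs, abs_mul, abs_mul, abs_of_nonneg (h1 n).1]
      have := hB x
      have := (h1 n).2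
      have h4 : |Kop D b G R (ζ (φ n)) x - Kop D b G R z x| ≤ KC + KC :=
        (abs_sub _ _).trans (add_le_add (h3 n) h2)
      have h5 := (abs_nonneg _).trans h4
      gcongr
    · filter_upwards [hζb, hKlim] with x h1 h2
      have h3 : Tendsto (fun n => M * |Kop D b G R (ζ (φ n)) x - Kop D b G R z x| * B)
          atTop (nhds 0) := by
        have h4 := (tendsto_sub_nhds_zero_iff.2 h2).abs
        simpa using (h4.const_mul M).mul_const B
      refine squeeze_zero_norm (fun n => ?_) h3
      rw [Real.norm_eq_abs, abs_mul, abs_mul, abs_of_nonneg (h1 n).1]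
      have := hB x
      have := (h1 n).2
      gcongr
  have hKbLp : MemLp (fun x => Kop D b G R z x * b x) 2 (volume.restrict D) := by
    refine MemLp.of_bound (C := KC * B) (hKz.mul hbm).aestronglyMeasurable ?_
    filter_upwards [hKzb] with x h1
    rw [Real.norm_eq_abs, abs_mul]
    have := hB x
    have := (abs_nonneg _).trans h1
    gcongr
  have hQ2 := hconv _ hKbLp
  have hintb : ∀ (n : ℕ) (w : Pt → ℝ), Measurable w → ∀ c : ℝ,
      (∀ᵐ x ∂(volume.restrict D), |w x| ≤ c) → Integrable w (volume.restrict D) := by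
    intro n w hw c hc
    exact Integrable.of_bound hw.aestronglyMeasurable c hc
  have hQlim : Tendsto (fun n => ∫ x in D, ζ (φ n) x * Kop D b G R (ζ (φ n)) x * b x) atTop
      (nhds (∫ x in D, z x * Kop D b G R z x * b x)) := by
    have h := hQ1.add hQ2
    rw [zero_add] at h
    have e0 : ∫ x in D, z x * Kop D b G R z x * b x = ∫ x in D, z x * (Kop D b G R z x * b x) := by
      congr 1; funext x; ring
    rw [e0]
    refine h.congr fun n => ?_
    have hKn := Kop_meas D b hbm G hGm R hRm _ (hζ (φ n)).1
    rw [← integral_add]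
    · congr 1; funext x; ring
    · refine hintb n _ (((hζ (φ n)).1.mul (hKn.sub hKz)).mul hbm) (M * (KC + KC) * B) ?_
      filter_upwards [hζb, hKzb, hKnb] with x h1 h2 h3
      rw [abs_mul, abs_mul, abs_of_nonneg (h1 n).1]
      have := hB x
      have := (h1 n).2
      have h4 : |Kop D b G R (ζ (φ n)) x - Kop D b G R z x| ≤ KC + KC :=
        (abs_sub _ _).trans (add_le_add (h3 n) h2)
      have h5 := (abs_nonneg _).trans h4
      gcongr
    · refine hintb n _ ((hζ (φ n)).1.mul (hKz.mul hbm)) (M * (KC * B)) ?_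
      filter_upwards [hζb, hKzb] with x h1 h2
      rw [abs_mul, abs_mul, abs_of_nonneg (h1 n).1]
      have := hB x
      have := (h1 n).2
      have h5 := (abs_nonneg _).trans h2
      gcongr
  -- the linear term
  have hLlim : Tendsto (fun n => ∫ x in D, q x * ζ (φ n) x * b x) atTop
      (nhds (∫ x in D, q x * z x * b x)) := by
    have e : ∀ (w : Pt → ℝ),
        ∫ y in D, q y * w y * b y = ∫ y in D, w y * (q y * b y) := by
      intro w; congr 1; funext y; ring
    simp only [e]
    refine hconv _ (MemLp.of_bound (C := Q * B) (hqm.mul hbm).aestronglyMeasurable (ae_of_all _ ?_))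
    intro x
    rw [Real.norm_eq_abs, abs_mul]
    have := hB x; have := hQ x
    have := (abs_nonneg _).trans (hQ 0)
    gcongr
  -- the convex term
  set c : ℝ := ε ^ 2 / δ with hc
  have hc0 : 0 ≤ c := by positivity
  set g : Pt → ℝ := fun x => finv (c * z x) * c * b x with hg
  have hgm : Measurable g :=
    ((hmono.measurable.comp (hzm.const_mul c)).mul_const c).mul hbm
  have hgb : ∀ᵐ x ∂(volume.restrict D), |g x| ≤ max |finv 0| |finv (c * M)| * c * B := by
    filter_upwards [hzb] with x hx
    have h1 : |finv (c * z x)| ≤ max |finv 0| |finv (c * M)| := by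
      refine abs_le_max_abs_abs (hmono ?_) (hmono ?_)
      · exact mul_nonneg hc0 hx.1
      · exact mul_le_mul_of_nonneg_left hx.2 hc0
    simp only [hg]
    rw [abs_mul, abs_mul, abs_of_nonneg hc0]
    have := hB x
    gcongr
  have hglim := hconv g (MemLp.of_bound hgm.aestronglyMeasurable _ hgb)
  have hFc := Fstar_cont finv hmono
  obtain ⟨CF, hCF⟩ := (isCompact_Icc (a := (0:ℝ)) (b := c * M)).exists_bound_of_continuousOn
    hFc.continuousOn
  have hPint : ∀ w : Pt → ℝ, Measurable w → (∀ᵐ x ∂(volume.restrict D), 0 ≤ w x ∧ w x ≤ M) →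
      Integrable (fun x => Fstar finv (c * w x) * b x) (volume.restrict D) := by
    intro w hw hwb
    refine hintb 0 _ ((hFc.measurable.comp (hw.const_mul c)).mul hbm) (CF * B) ?_
    filter_upwards [hwb] with x hx
    have h1 := hCF (c * w x) ⟨mul_nonneg hc0 hx.1, mul_le_mul_of_nonneg_left hx.2 hc0⟩
    rw [Real.norm_eq_abs] at h1
    have := hB x
    have := (abs_nonneg _).trans h1
    rw [abs_mul]
    gcongr
  have hgint : ∀ w : Pt → ℝ, Measurable w → (∀ᵐ x ∂(volume.restrict D), 0 ≤ w x ∧ w x ≤ M) →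
      Integrable (fun x => w x * g x) (volume.restrict D) := by
    intro w hw hwb
    refine hintb 0 _ (hw.mul hgm) (M * (max |finv 0| |finv (c * M)| * c * B)) ?_
    filter_upwards [hwb, hgb] with x hx h1
    rw [abs_mul, abs_of_nonneg hx.1]
    have := hx.2
    gcongr
  have hP : ∀ n, (∫ x in D, Fstar finv (c * z x) * b x) +
      ((∫ x in D, ζ (φ n) x * g x) - ∫ x in D, z x * g x)
      ≤ ∫ x in D, Fstar finv (c * ζ (φ n) x) * b x := by
    intro n
    have i1 := hgint _ (hζ (φ n)).1 (hζ (φ n)).2.1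
    have i2 := hgint z hzm hzb
    have i3 : Integrable (fun x => ζ (φ n) x * g x - z x * g x) (volume.restrict D) := i1.sub i2
    rw [← integral_sub i1 i2, ← integral_add (hPint z hzm hzb) i3]
    refine integral_mono ((hPint z hzm hzb).add i3) (hPint _ (hζ (φ n)).1 (hζ (φ n)).2.1) ?_
    intro x
    have h1 := Fstar_convex finv hmono (c * ζ (φ n) x) (c * z x)
    have h2 := mul_le_mul_of_nonneg_right h1 (hb0 x)
    simp only [hg]
    linarith
  refine ⟨φ, z, fun n => (1/2) * (∫ x in D, ζ (φ n) x * Kop D b G R (ζ (φ n)) x * b x)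
    + (∫ x in D, q x * ζ (φ n) x * b x)
    - (δ / ε ^ 2) * ((∫ x in D, Fstar finv (c * z x) * b x) +
      ((∫ x in D, ζ (φ n) x * g x) - ∫ x in D, z x * g x)), hφ, hzA, ?_, ?_⟩
  · have := ((hQlim.const_mul (1/2)).add hLlim).sub
      (((hglim.sub_const (∫ x in D, z x * g x)).const_add
        (∫ x in D, Fstar finv (c * z x) * b x)).const_mul (δ / ε ^ 2))
    rw [sub_self, add_zero] at this
    exact this
  · intro n
    unfold Efun
    have := mul_le_mul_of_nonneg_left (hP n) (show 0 ≤ δ / ε^2 by positivity)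
    linarith

lemma Kop_congr (D : Set Pt) (hD : MeasurableSet D) (b b' : Pt → ℝ) (hbb : EqOn b b' D)
    (G R : Pt → Pt → ℝ) (ζ : Pt → ℝ) : EqOn (Kop D b G R ζ) (Kop D b' G R ζ) D := by
  intro x hx
  unfold Kop
  rw [hbb hx]
  congr 1
  · congr 1
    exact setIntegral_congr_fun hD fun y hy => by simp only [hbb hy]
  · exact setIntegral_congr_fun hD fun y hy => by simp only [hbb hy]

lemma Efun_congr (D : Set Pt) (hD : MeasurableSet D) (b b' : Pt → ℝ) (hbb : EqOn b b' D)
    (q q' : Pt → ℝ) (hqq : EqOn q q' D) (G R : Pt → Pt → ℝ) (finv : ℝ → ℝ) (ε δ : ℝ)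
    (ζ : Pt → ℝ) : Efun D b q G R finv ε δ ζ = Efun D b' q' G R finv ε δ ζ := by
  unfold Efun
  congr 1
  · congr 1
    · congr 1
      exact setIntegral_congr_fun hD fun y hy => by
        simp only [hbb hy, Kop_congr D hD b b' hbb G R ζ hy]
    · exact setIntegral_congr_fun hD fun y hy => by simp only [hbb hy, hqq hy]
  · congr 1
    exact setIntegral_congr_fun hD fun y hy => by simp only [hbb hy]

lemma InA_congr (D : Set Pt) (hD : MeasurableSet D) (b b' : Pt → ℝ) (hbb : EqOn b b' D)
    (κ₀ ε δ Λ : ℝ) (ζ : Pt → ℝ) : InA D b κ₀ ε δ Λ ζ ↔ InA D b' κ₀ ε δ Λ ζ := by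
  unfold InA
  have : ∫ x in D, ζ x * b x = ∫ x in D, ζ x * b' x :=
    setIntegral_congr_fun hD fun y hy => by simp only [hbb hy]
  rw [this]

/-- A continuous function on the closure of a bounded open set, cut off outside the set. -/
lemma cutoff_aux (D : Set Pt) (hDo : IsOpen D) (hDbdd : Bornology.IsBounded D)
    (b : Pt → ℝ) (hb : ContinuousOn b (closure D)) :
    Measurable (D.indicator b) ∧ ∃ B, ∀ x, |D.indicator b x| ≤ B := by
  classical
  constructor
  · have := (hb.mono subset_closure).measurable_piecewise
      (continuousOn_const (c := (0:ℝ)) (s := Dᶜ)) hDo.measurableSet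
    rw [← piecewise_eq_indicator]; exact this
  · obtain ⟨B, hB⟩ := hDbdd.isCompact_closure.exists_bound_of_continuousOn hb
    refine ⟨max B 0, fun x => ?_⟩
    by_cases hx : x ∈ D
    · rw [indicator_of_mem hx]; exact (hB x (subset_closure hx)).trans (le_max_left _ _)
    · rw [indicator_of_notMem hx]; simp

/-- Lemma 2.1: the functional `E` is bounded above on `A_{ε,Λ}` and attains
its maximum there. -/
theorem stmt1
    -- the domain
    (D : Set Pt) (hDo : IsOpen D) (hDne : D.Nonempty) (hDbdd : Bornology.IsBounded D)
    -- the depth function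
    (b : Pt → ℝ) (hb : ContinuousOn b (closure D)) (hbpos : ∀ x ∈ D, 0 < b x)
    -- the background stream function
    (q : Pt → ℝ) (hq : ContinuousOn q (closure D))
    -- the kernel G
    (G : Pt → Pt → ℝ) (hGm : Measurable (Function.uncurry G))
    (hGsymm : ∀ x y, G x y = G y x)
    (hGbd : ∀ᵐ p ∂((volume.restrict D).prod (volume.restrict D)),
      0 ≤ G p.1 p.2 ∧ G p.1 p.2 ≤ (1 / (2 * π)) * log (diam D / dist p.1 p.2))
    -- the correction kernel R
    (R : Pt → Pt → ℝ) (hRm : Measurable (Function.uncurry R))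
    (hRsymm : ∀ x y, R x y = R y x) (CR : ℝ) (hCR : ∀ x y, |R x y| ≤ CR)
    -- the nonlinearity f satisfying (H1) with f → ∞ at ∞, and its inverse finv
    (f : ℝ → ℝ) (f0 : ℝ)
    (hfc : ContinuousOn f ({(0:ℝ)}ᶜ)) (hfneg : ∀ s ≤ (0:ℝ), f s = 0)
    (hfmono : StrictMonoOn f (Ici (0:ℝ)))
    (hf0 : Tendsto f (nhdsWithin 0 (Ioi 0)) (nhds f0)) (hf0n : 0 ≤ f0)
    (hfinf : Tendsto f atTop atTop)
    (finv : ℝ → ℝ) (hfinv0 : ∀ s ≤ f0, finv s = 0)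
    (hfinvl : ∀ s ≥ (0:ℝ), finv (f s) = s) (hfinvr : ∀ t ≥ f0, f (finv t) = t)
    -- the parameters
    (κ₀ ε δ Λ : ℝ) (hκ : 0 < κ₀) (hε : ε ∈ Ioo (0:ℝ) 1) (hδ : δ ∈ Ioo (0:ℝ) 1)
    (hΛ : Λ > f0 + 1) (hne : Λ * (∫ x in D, b x) ≥ κ₀ * ε ^ 2) :
    BddAbove (Efun D b q G R finv ε δ '' {ζ | InA D b κ₀ ε δ Λ ζ}) ∧
    ∃ ζ₀, InA D b κ₀ ε δ Λ ζ₀ ∧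
      ∀ ζ, InA D b κ₀ ε δ Λ ζ → Efun D b q G R finv ε δ ζ ≤ Efun D b q G R finv ε δ ζ₀ := by
  have hD : MeasurableSet D := hDo.measurableSet
  have hfin : IsFiniteMeasure (volume.restrict D) :=
    ⟨by rw [Measure.restrict_apply_univ]; exact hDbdd.measure_lt_top⟩
  -- `finv` is monotone
  have hmono : Monotone finv := by
    have hpos : ∀ t, f0 < t → 0 < finv t := by
      intro t ht
      by_contra h
      have h1 := hfneg (finv t) (not_lt.1 h)
      rw [hfinvr t ht.le] at h1
      linarith
    intro s t hst
    rcases le_or_gt t f0 with ht | ht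
    · rw [hfinv0 t ht, hfinv0 s (hst.trans ht)]
    rcases le_or_gt s f0 with hs | hs
    · rw [hfinv0 s hs]; exact (hpos t ht).le
    by_contra h
    have h1 := hfmono (hpos t ht).le (hpos s hs).le (not_le.1 h)
    rw [hfinvr t ht.le, hfinvr s hs.le] at h1
    linarith
  have hΛ0 : 0 < Λ := by linarith
  obtain ⟨hbm, B, hB⟩ := cutoff_aux D hDo hDbdd b hb
  obtain ⟨hqm, Q, hQ⟩ := cutoff_aux D hDo hDbdd q hq
  have hbb : EqOn b (D.indicator b) D := fun x hx => (indicator_of_mem hx b).symm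
  have hqq : EqOn q (D.indicator q) D := fun x hx => (indicator_of_mem hx q).symm
  have hb0 : ∀ x, 0 ≤ D.indicator b x := indicator_nonneg fun x hx => (hbpos x hx).le
  have hseq : ∀ ζ : ℕ → Pt → ℝ, (∀ n, InA D b κ₀ ε δ Λ (ζ n)) →
      ∃ (φ : ℕ → ℕ) (z : Pt → ℝ) (h : ℕ → ℝ), StrictMono φ ∧ InA D b κ₀ ε δ Λ z ∧
      Tendsto h atTop (nhds (Efun D b q G R finv ε δ z)) ∧
      ∀ n, Efun D b q G R finv ε δ (ζ (φ n)) ≤ h n := by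
    intro ζ hζ
    simp only [InA_congr D hD b _ hbb, Efun_congr D hD b _ hbb q _ hqq] at hζ ⊢
    exact seq_aux D hD hDbdd _ hbm B hB hb0 _ hqm Q hQ G hGm hGbd R hRm CR hCR finv hmono
      κ₀ ε δ Λ hε.1 hδ.1 hΛ0 ζ hζ
  have hbdd : BddAbove (Efun D b q G R finv ε δ '' {ζ | InA D b κ₀ ε δ Λ ζ}) := by
    by_contra hcon
    rw [not_bddAbove_iff] at hcon
    have : ∀ n : ℕ, ∃ ζ, InA D b κ₀ ε δ Λ ζ ∧ (n:ℝ) < Efun D b q G R finv ε δ ζ := by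
      intro n
      obtain ⟨_, ⟨ζ, hζ, rfl⟩, h⟩ := hcon n
      exact ⟨ζ, hζ, h⟩
    choose ζ hζ hE using this
    obtain ⟨φ, z, h, hφ, -, hlim, hle⟩ := hseq ζ hζ
    have h1 : Tendsto h atTop atTop := by
      refine tendsto_atTop_mono (fun n => ?_) tendsto_natCast_atTop_atTop
      have h2 : (n:ℝ) ≤ (φ n : ℝ) := by exact_mod_cast hφ.id_le n
      exact h2.trans ((hE (φ n)).le.trans (hle n))
    exact not_tendsto_nhds_of_tendsto_atTop h1 _ hlim
  refine ⟨hbdd, ?_⟩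
  -- the class is nonempty
  have hne' : (Efun D b q G R finv ε δ '' {ζ | InA D b κ₀ ε δ Λ ζ}).Nonempty := by
    set I := ∫ x in D, b x with hI
    have hεp := hε.1
    have hδp := hδ.1
    have hIpos : 0 < I := by
      have h1 : 0 < Λ * I := lt_of_lt_of_le (by positivity) hne
      exact pos_of_mul_pos_right h1 hΛ0.le
    refine ⟨_, fun _ => κ₀ * δ / I, ⟨measurable_const, ae_of_all _ fun x => ⟨by positivity, ?_⟩, ?_⟩, rfl⟩
    · rw [div_le_div_iff₀ hIpos (by positivity)]
      nlinarith
    · rw [integral_const_mul, ← hI]; field_simp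
  set S := sSup (Efun D b q G R finv ε δ '' {ζ | InA D b κ₀ ε δ Λ ζ}) with hS
  have : ∀ n : ℕ, ∃ ζ, InA D b κ₀ ε δ Λ ζ ∧ S - 1 / ((n:ℝ) + 1) < Efun D b q G R finv ε δ ζ := by
    intro n
    obtain ⟨_, ⟨ζ, hζ, rfl⟩, h⟩ := exists_lt_of_lt_csSup hne'
      (show S - 1 / ((n:ℝ) + 1) < S from sub_lt_self _ Nat.one_div_pos_of_nat)
    exact ⟨ζ, hζ, h⟩
  choose ζ hζ hE using this
  obtain ⟨φ, z, h, hφ, hz, hlim, hle⟩ := hseq ζ hζ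
  refine ⟨z, hz, fun w hw => ?_⟩
  have h1 : Tendsto (fun n => S - 1 / (((φ n : ℕ) : ℝ) + 1)) atTop (nhds S) := by
    have := (tendsto_one_div_add_atTop_nhds_zero_nat (𝕜 := ℝ)).comp hφ.tendsto_atTop
    simpa using this.const_sub S
  have h2 : S ≤ Efun D b q G R finv ε δ z :=
    le_of_tendsto_of_tendsto' h1 hlim fun n => (hE (φ n)).le.trans (hle n)
  exact (le_csSup hbdd ⟨w, hw, rfl⟩).trans h2
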